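/- (End-to-end rate of hierarchical CoCoA, strongly convex case.) Suppose each g_i is μ-strongly convex with μ > 0, σ > 0 is compatible with the partition (‖Ax‖² ≤ σ Σ_{k=1}^K ‖A x_[k]‖² for all x), c_A > 0 satisfies ‖Ax‖² ≤ c_A ‖x‖² for all x ∈ ℝ^n, and F attains its minimum value F*. Let σ̄ ≥ 1, θ̄ ∈ (0,1], and let t₂ ≥ 1 be the number of inner iterations, and set θ := (1 − (1−θ̄)·(βσ c_A + μ)/(σ̄ σ β c_A + μ))^{t₂} ∈ (0,1]. Let (α^(t))_{t≥0} be a CoCoA sequence with approximation quality θ (as is guaranteed when each outer local subproblem is solved by t₂ inner CoCoA iterations whose subtasks are solved θ̄-approximately). Then after t₁ outer iterations the suboptimality ε := F(α^(t₁)) − F* satisfies ε ≤ (1 − [1 − (1 − (1−θ̄)·(βσ c_A + μ)/(σ̄ σ β c_A + μ))^{t₂}]·μ/(μ + σβ c_A))^{t₁} · (F(α^(0)) − F*). -/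

import Mathlib

open RealInnerProductSpace Finset

noncomputable section

/-- Matrix–vector product `A x` viewed as a map between Euclidean spaces. -/
def mulVecE {d n : ℕ} (A : Matrix (Fin d) (Fin n) ℝ) (x : EuclideanSpace ℝ (Fin n)) :
    EuclideanSpace ℝ (Fin d) :=
  (WithLp.equiv 2 _).symm (A.mulVec ((WithLp.equiv 2 _) x))

/-- `restr I x` (written `x_[k]` in the paper) equals `x` on the coordinates in `I`
and is zero elsewhere. -/
def restr {n : ℕ} (I : Finset (Fin n)) (x : EuclideanSpace ℝ (Fin n)) :
    EuclideanSpace ℝ (Fin n) :=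
  (WithLp.equiv 2 _).symm (fun i => if i ∈ I then x i else 0)

/-- The global objective `F(α) = f(Aα) + ∑ i g i (α i)`. -/
def objF {d n : ℕ} (A : Matrix (Fin d) (Fin n) ℝ) (f : EuclideanSpace ℝ (Fin d) → ℝ)
    (g : Fin n → ℝ → ℝ) (α : EuclideanSpace ℝ (Fin n)) : ℝ :=
  f (mulVecE A α) + ∑ i, g i (α i)

/-- The CoCoA local subproblem objective
`F_σ^{(k)}(Δ; α, v) = (1/K) f(v) + ⟨∇f(v), AΔ⟩ + (σβ/2)‖AΔ‖² + ∑_{i ∈ I_k} g i (α i + Δ i)`,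
where `v = Aα` and `f'` is the gradient of `f`. -/
def locF {d n : ℕ} (A : Matrix (Fin d) (Fin n) ℝ) (f : EuclideanSpace ℝ (Fin d) → ℝ)
    (f' : EuclideanSpace ℝ (Fin d) → EuclideanSpace ℝ (Fin d))
    (g : Fin n → ℝ → ℝ) (K : ℕ) (σ β : ℝ) (Ik : Finset (Fin n))
    (α Δ : EuclideanSpace ℝ (Fin n)) : ℝ :=
  (1 / (K : ℝ)) * f (mulVecE A α) + ⟪f' (mulVecE A α), mulVecE A Δ⟫
    + σ * β / 2 * ‖mulVecE A Δ‖ ^ 2 + ∑ i ∈ Ik, g i (α i + Δ i)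

/-- Infimum of the local subproblem objective over vectors supported on `Ik`. -/
def locInf {d n : ℕ} (A : Matrix (Fin d) (Fin n) ℝ) (f : EuclideanSpace ℝ (Fin d) → ℝ)
    (f' : EuclideanSpace ℝ (Fin d) → EuclideanSpace ℝ (Fin d))
    (g : Fin n → ℝ → ℝ) (K : ℕ) (σ β : ℝ) (Ik : Finset (Fin n))
    (α : EuclideanSpace ℝ (Fin n)) : ℝ :=
  sInf ((locF A f f' g K σ β Ik α) '' {Δ | ∀ i ∉ Ik, Δ i = 0})

/-- `Δk` is a θ-approximate solution of the `k`-th local subproblem at `α`. -/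
def IsApprox {d n : ℕ} (A : Matrix (Fin d) (Fin n) ℝ) (f : EuclideanSpace ℝ (Fin d) → ℝ)
    (f' : EuclideanSpace ℝ (Fin d) → EuclideanSpace ℝ (Fin d))
    (g : Fin n → ℝ → ℝ) (K : ℕ) (σ β θ : ℝ) (Ik : Finset (Fin n))
    (α Δk : EuclideanSpace ℝ (Fin n)) : Prop :=
  (∀ i ∉ Ik, Δk i = 0) ∧
    locF A f f' g K σ β Ik α Δk - locInf A f f' g K σ β Ik α ≤
      θ * (locF A f f' g K σ β Ik α 0 - locInf A f f' g K σ β Ik α)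

theorem mulVecE_add {d n : ℕ} (A : Matrix (Fin d) (Fin n) ℝ) (x y : EuclideanSpace ℝ (Fin n)) :
    mulVecE A (x + y) = mulVecE A x + mulVecE A y := by
  simp [mulVecE, Matrix.mulVec_add]

theorem mulVecE_smul {d n : ℕ} (A : Matrix (Fin d) (Fin n) ℝ) (c : ℝ)
    (x : EuclideanSpace ℝ (Fin n)) : mulVecE A (c • x) = c • mulVecE A x := by
  simp [mulVecE, Matrix.mulVec_smul]

theorem mulVecE_zero {d n : ℕ} (A : Matrix (Fin d) (Fin n) ℝ) : mulVecE A 0 = 0 := by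
  simpa using mulVecE_smul A 0 0

theorem mulVecE_sum {d n : ℕ} {ι : Type*} (A : Matrix (Fin d) (Fin n) ℝ) (s : Finset ι)
    (x : ι → EuclideanSpace ℝ (Fin n)) :
    mulVecE A (∑ k ∈ s, x k) = ∑ k ∈ s, mulVecE A (x k) := by
  classical
  induction s using Finset.induction_on with
  | empty => simp [mulVecE_zero]
  | insert a s ha ih => rw [sum_insert ha, sum_insert ha, mulVecE_add, ih]

theorem restr_apply {n : ℕ} (J : Finset (Fin n)) (x : EuclideanSpace ℝ (Fin n)) (i : Fin n) :
    restr J x i = if i ∈ J then x i else 0 := rfl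

theorem norm_sq_restr {n : ℕ} (J : Finset (Fin n)) (x : EuclideanSpace ℝ (Fin n)) :
    ‖restr J x‖ ^ 2 = ∑ i ∈ J, x i ^ 2 := by
  simp [EuclideanSpace.real_norm_sq_eq, restr_apply, ite_pow]

/-- A convex function on `ℝ` has an affine minorant touching it at `0`. -/
theorem ConvexOn.exists_affine_le {h : ℝ → ℝ} (hh : ConvexOn ℝ Set.univ h) :
    ∃ c : ℝ, ∀ x, h 0 + c * x ≤ h x := by
  refine ⟨derivWithin h (Set.Ioi 0) 0, fun x => ?_⟩
  rcases lt_trichotomy x 0 with hx | rfl | hx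
  · have h1 := hh.slope_le_leftDeriv_of_mem_interior (Set.mem_univ x) (by simp) hx
    have h2 := hh.leftDeriv_le_rightDeriv_of_mem_interior (x := 0) (by simp)
    have h3 := h1.trans h2
    rw [slope_def_field, div_le_iff₀ (by linarith)] at h3
    linarith
  · simp
  · have h1 := hh.rightDeriv_le_slope_of_mem_interior (x := 0) (by simp) (Set.mem_univ x) hx
    rw [slope_def_field, le_div_iff₀ (by linarith)] at h1
    linarith

theorem StrongConvexOn.exists_forall_le {h : ℝ → ℝ} {μ : ℝ} (hμ : 0 < μ)
    (hh : StrongConvexOn Set.univ μ h) : ∃ m : ℝ, ∀ x, m ≤ h x := by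
  obtain ⟨c, hc⟩ := (strongConvexOn_iff_convex.1 hh).exists_affine_le
  refine ⟨h 0 - c ^ 2 / (2 * μ), fun x => ?_⟩
  have h1 := hc x
  simp only [Real.norm_eq_abs, sq_abs] at h1
  have h2 : c * x + μ / 2 * x ^ 2 + c ^ 2 / (2 * μ) = (μ * x + c) ^ 2 / (2 * μ) := by
    field_simp
    ring
  have h3 : 0 ≤ (μ * x + c) ^ 2 / (2 * μ) := by positivity
  simp only [ne_eq, OfNat.ofNat_ne_zero, not_false_eq_true, zero_pow, mul_zero, sub_zero] at h1
  linarith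

theorem ConvexOn.add_inner_gradient_le {E : Type*} [NormedAddCommGroup E] [InnerProductSpace ℝ E]
    [CompleteSpace E] {f : E → ℝ} (hf : ConvexOn ℝ Set.univ f) {u p : E}
    (hp : HasGradientAt f p u) (y : E) : f u + ⟪p, y⟫ ≤ f (u + y) := by
  have hconv : ConvexOn ℝ Set.univ (fun t : ℝ => f (u + t • y)) := by
    have := hf.comp_affineMap (AffineMap.lineMap u (u + y) : ℝ →ᵃ[ℝ] E)
    simpa [Function.comp_def, AffineMap.lineMap_apply, add_comm] using this
  have hderiv : HasDerivAt (fun t : ℝ => f (u + t • y)) ⟪p, y⟫ 0 := by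
    have h1 : HasDerivAt (fun t : ℝ => u + t • y) y 0 := by
      simpa using ((hasDerivAt_id (0 : ℝ)).smul_const y).const_add u
    have h2 : HasFDerivAt f (InnerProductSpace.toDual ℝ E p) (u + (0 : ℝ) • y) := by
      simpa using hp.hasFDerivAt
    exact h2.comp_hasDerivAt 0 h1
  have h := hconv.le_slope_of_hasDerivAt (Set.mem_univ 0) (Set.mem_univ 1) one_pos hderiv
  simp only [slope_def_field, one_smul, zero_smul, add_zero, sub_zero, div_one] at h
  linarith

theorem sum_eq_sum_partition {n K : ℕ} {I : Fin K → Finset (Fin n)}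
    (hdisj : ∀ k l, k ≠ l → Disjoint (I k) (I l)) (hcover : ∀ i, ∃ k, i ∈ I k) (φ : Fin n → ℝ) :
    ∑ i, φ i = ∑ k, ∑ i ∈ I k, φ i := by
  rw [← sum_biUnion fun k _ l _ hkl => hdisj k l hkl]
  congr 1
  ext i
  simpa using hcover i

theorem sum_apply_of_supported {n K : ℕ} {I : Fin K → Finset (Fin n)}
    (hdisj : ∀ k l, k ≠ l → Disjoint (I k) (I l)) {x : Fin K → EuclideanSpace ℝ (Fin n)}
    (hx : ∀ k, ∀ i ∉ I k, x k i = 0) {k : Fin K} {i : Fin n} (hi : i ∈ I k) :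
    (∑ l, x l) i = x k i := by
  rw [WithLp.ofLp_sum, Finset.sum_apply]
  refine sum_eq_single k (fun l _ hl => hx l i fun hil => ?_) (by simp)
  exact disjoint_left.1 (hdisj l k hl) hil hi

theorem restr_sum_of_supported {n K : ℕ} {I : Fin K → Finset (Fin n)}
    (hdisj : ∀ k l, k ≠ l → Disjoint (I k) (I l)) {x : Fin K → EuclideanSpace ℝ (Fin n)}
    (hx : ∀ k, ∀ i ∉ I k, x k i = 0) (k : Fin K) : restr (I k) (∑ l, x l) = x k := by
  ext i
  rw [restr_apply]
  split_ifs with hi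
  · exact sum_apply_of_supported hdisj hx hi
  · exact (hx k i hi).symm

theorem locInf_le {d n K : ℕ} (A : Matrix (Fin d) (Fin n) ℝ) (f : EuclideanSpace ℝ (Fin d) → ℝ)
    (f' : EuclideanSpace ℝ (Fin d) → EuclideanSpace ℝ (Fin d)) {β : ℝ} (hβ : 0 < β)
    {g : Fin n → ℝ → ℝ} {μ : ℝ} (hμ : 0 < μ) (hg : ∀ i, StrongConvexOn Set.univ μ (g i))
    {σ : ℝ} (hσ : 0 < σ) (J : Finset (Fin n)) (α : EuclideanSpace ℝ (Fin n))
    {x : EuclideanSpace ℝ (Fin n)} (hx : ∀ i ∉ J, x i = 0) :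
    locInf A f f' g K σ β J α ≤ locF A f f' g K σ β J α x := by
  refine csInf_le ?_ ⟨x, hx, rfl⟩
  choose m hm using fun i => (hg i).exists_forall_le hμ
  set p := f' (mulVecE A α) with hp
  refine ⟨1 / (K : ℝ) * f (mulVecE A α) - ‖p‖ ^ 2 / (2 * (σ * β)) + ∑ i ∈ J, m i, ?_⟩
  rintro _ ⟨y, -, rfl⟩
  have hsum : ∑ i ∈ J, m i ≤ ∑ i ∈ J, g i (α i + y i) := sum_le_sum fun i _ => hm i _
  have hinner : -(‖p‖ * ‖mulVecE A y‖) ≤ ⟪p, mulVecE A y⟫ :=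
    (abs_le.1 (abs_real_inner_le_norm p (mulVecE A y))).1
  have hσβ : 0 < σ * β := mul_pos hσ hβ
  have hsq : ‖p‖ ^ 2 / (2 * (σ * β)) - ‖p‖ * ‖mulVecE A y‖ + σ * β / 2 * ‖mulVecE A y‖ ^ 2
      = (σ * β * ‖mulVecE A y‖ - ‖p‖) ^ 2 / (2 * (σ * β)) := by
    field_simp
    ring
  have hnn : 0 ≤ (σ * β * ‖mulVecE A y‖ - ‖p‖) ^ 2 / (2 * (σ * β)) := by positivity
  unfold locF
  rw [← hp]
  linarith

theorem sum_locF {d n K : ℕ} (hK : K ≠ 0) (A : Matrix (Fin d) (Fin n) ℝ)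
    (f : EuclideanSpace ℝ (Fin d) → ℝ) (f' : EuclideanSpace ℝ (Fin d) → EuclideanSpace ℝ (Fin d))
    (g : Fin n → ℝ → ℝ) {I : Fin K → Finset (Fin n)}
    (hdisj : ∀ k l, k ≠ l → Disjoint (I k) (I l)) (hcover : ∀ i, ∃ k, i ∈ I k) (σ β : ℝ)
    (α : EuclideanSpace ℝ (Fin n)) {x : Fin K → EuclideanSpace ℝ (Fin n)}
    (hx : ∀ k, ∀ i ∉ I k, x k i = 0) :
    ∑ k, locF A f f' g K σ β (I k) α (x k) =
      f (mulVecE A α) + ⟪f' (mulVecE A α), mulVecE A (∑ k, x k)⟫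
        + σ * β / 2 * ∑ k, ‖mulVecE A (x k)‖ ^ 2 + ∑ i, g i (α i + (∑ k, x k) i) := by
  have hK' : (K : ℝ) ≠ 0 := Nat.cast_ne_zero.2 hK
  have hgsum : ∑ i, g i (α i + (∑ k, x k) i) = ∑ k, ∑ i ∈ I k, g i (α i + x k i) := by
    rw [sum_eq_sum_partition hdisj hcover]
    refine sum_congr rfl fun k _ => sum_congr rfl fun i hi => ?_
    rw [sum_apply_of_supported hdisj hx hi]
  have hfsum : ∑ _k : Fin K, 1 / (K : ℝ) * f (mulVecE A α) = f (mulVecE A α) := by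
    rw [sum_const, card_univ, Fintype.card_fin, nsmul_eq_mul]
    field_simp
  simp only [locF, sum_add_distrib]
  rw [hfsum, hgsum, mulVecE_sum, inner_sum, mul_sum]

theorem objF_add_le_sum_locF {d n K : ℕ} (hK : K ≠ 0) (A : Matrix (Fin d) (Fin n) ℝ)
    {f : EuclideanSpace ℝ (Fin d) → ℝ} {f' : EuclideanSpace ℝ (Fin d) → EuclideanSpace ℝ (Fin d)}
    {β : ℝ} (hβ : 0 < β)
    (hsmooth : ∀ u w : EuclideanSpace ℝ (Fin d),
      f w ≤ f u + ⟪f' u, w - u⟫ + β / 2 * ‖w - u‖ ^ 2)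
    (g : Fin n → ℝ → ℝ) {I : Fin K → Finset (Fin n)}
    (hdisj : ∀ k l, k ≠ l → Disjoint (I k) (I l)) (hcover : ∀ i, ∃ k, i ∈ I k) {σ : ℝ}
    (hcompat : ∀ x : EuclideanSpace ℝ (Fin n),
      ‖mulVecE A x‖ ^ 2 ≤ σ * ∑ k, ‖mulVecE A (restr (I k) x)‖ ^ 2)
    (α : EuclideanSpace ℝ (Fin n)) {x : Fin K → EuclideanSpace ℝ (Fin n)}
    (hx : ∀ k, ∀ i ∉ I k, x k i = 0) :
    objF A f g (α + ∑ k, x k) ≤ ∑ k, locF A f f' g K σ β (I k) α (x k) := by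
  rw [sum_locF hK A f f' g hdisj hcover σ β α hx]
  have h1 := hsmooth (mulVecE A α) (mulVecE A (α + ∑ k, x k))
  rw [mulVecE_add, add_sub_cancel_left] at h1
  have h2 := hcompat (∑ k, x k)
  simp only [restr_sum_of_supported hdisj hx] at h2
  have h3 := mul_le_mul_of_nonneg_left h2 (by positivity : 0 ≤ β / 2)
  simp only [objF, mulVecE_add, PiLp.add_apply]
  linarith

/-- A step of length `s = μ / (μ + σ β c_A)` towards `z` bounds the optimal values of the local
subproblems. -/
theorem sum_locInf_le {d n K : ℕ} (hK : K ≠ 0) (A : Matrix (Fin d) (Fin n) ℝ)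
    {f : EuclideanSpace ℝ (Fin d) → ℝ} {f' : EuclideanSpace ℝ (Fin d) → EuclideanSpace ℝ (Fin d)}
    {β : ℝ} (hβ : 0 < β) (hconvf : ConvexOn ℝ Set.univ f)
    (hgrad : ∀ u, HasGradientAt f (f' u) u)
    {g : Fin n → ℝ → ℝ} {μ : ℝ} (hμ : 0 < μ) (hg : ∀ i, StrongConvexOn Set.univ μ (g i))
    {I : Fin K → Finset (Fin n)}
    (hdisj : ∀ k l, k ≠ l → Disjoint (I k) (I l)) (hcover : ∀ i, ∃ k, i ∈ I k)
    {σ : ℝ} (hσ : 0 < σ) {cA : ℝ} (hcA : 0 < cA)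
    (hAbound : ∀ x : EuclideanSpace ℝ (Fin n), ‖mulVecE A x‖ ^ 2 ≤ cA * ‖x‖ ^ 2)
    (α z : EuclideanSpace ℝ (Fin n)) :
    ∑ k, locInf A f f' g K σ β (I k) α ≤
      objF A f g α - μ / (μ + σ * β * cA) * (objF A f g α - objF A f g z) := by
  have hden : 0 < μ + σ * β * cA := by positivity
  set s := μ / (μ + σ * β * cA) with hs
  have hs0 : 0 ≤ s := by positivity
  have hs1 : s ≤ 1 := (div_le_one hden).2 (by linarith [mul_pos (mul_pos hσ hβ) hcA])
  have hsμ : σ * β * cA * s = μ * (1 - s) := by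
    have : s * (μ + σ * β * cA) = μ := div_mul_cancel₀ _ hden.ne'
    linarith
  set y := z - α with hy
  set x : Fin K → EuclideanSpace ℝ (Fin n) := fun k => restr (I k) (s • y) with hxdef
  have hx : ∀ k, ∀ i ∉ I k, x k i = 0 := fun k i hi => by simp [hxdef, restr_apply, hi]
  have hsumx : ∑ k, x k = s • y := by
    ext i
    obtain ⟨k, hk⟩ := hcover i
    rw [sum_apply_of_supported hdisj hx hk]
    simp [hxdef, restr_apply, hk]
  have hnorm : ∑ k, ‖mulVecE A (x k)‖ ^ 2 ≤ cA * (s ^ 2 * ‖y‖ ^ 2) := by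
    calc ∑ k, ‖mulVecE A (x k)‖ ^ 2 ≤ ∑ k, cA * ‖x k‖ ^ 2 := sum_le_sum fun k _ => hAbound _
      _ = cA * ∑ i, (s • y) i ^ 2 := by
        rw [← mul_sum, sum_eq_sum_partition hdisj hcover]
        simp only [hxdef, norm_sq_restr]
      _ = cA * (s ^ 2 * ‖y‖ ^ 2) := by
        rw [← EuclideanSpace.real_norm_sq_eq, norm_smul, mul_pow, Real.norm_eq_abs, sq_abs]
  have hgi : ∀ i, g i (α i + (s • y) i) ≤
      (1 - s) * g i (α i) + s * g i (z i) - s * (1 - s) * (μ / 2) * y i ^ 2 := fun i => by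
    have h := (hg i).2 (Set.mem_univ (α i)) (Set.mem_univ (z i)) (sub_nonneg.2 hs1) hs0
      (sub_add_cancel 1 s)
    have e1 : (1 - s) • α i + s • z i = α i + (s • y) i := by
      simp [hy]
      ring
    have e2 : ‖α i - z i‖ ^ 2 = y i ^ 2 := by
      simp only [hy, Real.norm_eq_abs, sq_abs, PiLp.sub_apply]
      ring
    rw [e1] at h
    simp only [e2, smul_eq_mul] at h
    linarith
  have hgsum : ∑ i, g i (α i + (s • y) i) ≤
      (1 - s) * ∑ i, g i (α i) + s * ∑ i, g i (z i) - s * (1 - s) * (μ / 2) * ‖y‖ ^ 2 := by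
    rw [EuclideanSpace.real_norm_sq_eq, mul_sum, mul_sum, mul_sum, ← sum_add_distrib,
      ← sum_sub_distrib]
    exact sum_le_sum fun i _ => hgi i
  have hf := hconvf.add_inner_gradient_le (hgrad (mulVecE A α)) (mulVecE A y)
  rw [← mulVecE_add, hy, add_sub_cancel, ← hy] at hf
  have hf' := mul_le_mul_of_nonneg_left hf hs0
  have hquad := mul_le_mul_of_nonneg_left hnorm (by positivity : 0 ≤ σ * β / 2)
  have hcancel : σ * β / 2 * (cA * (s ^ 2 * ‖y‖ ^ 2)) = s * (1 - s) * (μ / 2) * ‖y‖ ^ 2 := by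
    linear_combination (s * ‖y‖ ^ 2 / 2) * hsμ
  calc ∑ k, locInf A f f' g K σ β (I k) α
      ≤ ∑ k, locF A f f' g K σ β (I k) α (x k) :=
        sum_le_sum fun k _ => locInf_le A f f' hβ hμ hg hσ (I k) α (hx k)
    _ ≤ _ := by
        rw [sum_locF hK A f f' g hdisj hcover σ β α hx, hsumx, mulVecE_smul, inner_smul_right]
        unfold objF
        linarith

theorem quality_mem_Icc {a μ σb θb : ℝ} (ha : 0 < a) (hμ : 0 < μ) (hσb : 1 ≤ σb)
    (hθb : θb ∈ Set.Ioc (0 : ℝ) 1) (t : ℕ) :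
    (1 - (1 - θb) * ((a + μ) / (σb * a + μ))) ^ t ∈ Set.Icc (0 : ℝ) 1 := by
  have hle : a ≤ σb * a := le_mul_of_one_le_left ha.le hσb
  have h0 : 0 ≤ (a + μ) / (σb * a + μ) := div_nonneg (by linarith) (by linarith)
  have h1 : (a + μ) / (σb * a + μ) ≤ 1 := (div_le_one (by linarith)).2 (by linarith)
  have h2 : 0 ≤ 1 - θb := sub_nonneg.2 hθb.2
  have h3 : (1 - θb) * ((a + μ) / (σb * a + μ)) ≤ 1 :=
    mul_le_one₀ (by linarith [hθb.1]) h0 h1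
  have h4 := mul_nonneg h2 h0
  exact ⟨pow_nonneg (by linarith) t, pow_le_one₀ (by linarith) (by linarith)⟩

/-- end-to-end rate of hierarchical CoCoA, strongly convex case.
With `θ = (1 − (1−θ̄)(βσc_A + μ)/(σ̄σβc_A + μ))^{t₂}`, a CoCoA sequence with
approximation quality `θ` satisfies, after `t₁` outer iterations,
`ε ≤ (1 − [1 − (1 − (1−θ̄)(βσc_A + μ)/(σ̄σβc_A + μ))^{t₂}]·μ/(μ + σβc_A))^{t₁} ε^(0)`. -/
theorem stmt_11 {d n K : ℕ} (A : Matrix (Fin d) (Fin n) ℝ)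
    (f : EuclideanSpace ℝ (Fin d) → ℝ)
    (f' : EuclideanSpace ℝ (Fin d) → EuclideanSpace ℝ (Fin d))
    (β : ℝ) (hβ : 0 < β)
    (hconvf : ConvexOn ℝ Set.univ f)
    (hgrad : ∀ u, HasGradientAt f (f' u) u)
    (hsmooth : ∀ u w : EuclideanSpace ℝ (Fin d),
      f w ≤ f u + ⟪f' u, w - u⟫ + β / 2 * ‖w - u‖ ^ 2)
    (g : Fin n → ℝ → ℝ) (μ : ℝ) (hμ : 0 < μ)
    (hg : ∀ i, StrongConvexOn Set.univ μ (g i))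
    (I : Fin K → Finset (Fin n))
    (hne : ∀ k, (I k).Nonempty)
    (hdisj : ∀ k l, k ≠ l → Disjoint (I k) (I l))
    (hcover : ∀ i, ∃ k, i ∈ I k)
    (σ : ℝ) (hσ : 0 < σ)
    (hcompat : ∀ x : EuclideanSpace ℝ (Fin n),
      ‖mulVecE A x‖ ^ 2 ≤ σ * ∑ k, ‖mulVecE A (restr (I k) x)‖ ^ 2)
    (cA : ℝ) (hcA : 0 < cA)
    (hAbound : ∀ x : EuclideanSpace ℝ (Fin n), ‖mulVecE A x‖ ^ 2 ≤ cA * ‖x‖ ^ 2)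
    (αstar : EuclideanSpace ℝ (Fin n))
    (hmin : ∀ x : EuclideanSpace ℝ (Fin n), objF A f g αstar ≤ objF A f g x)
    (σb : ℝ) (hσb : 1 ≤ σb) (θb : ℝ) (hθb : θb ∈ Set.Ioc (0 : ℝ) 1)
    (t₂ : ℕ) (ht₂ : 1 ≤ t₂)
    -- the approximation quality achieved by t₂ inner iterations:
    (θ : ℝ)
    (hθdef : θ = (1 - (1 - θb) * ((β * σ * cA + μ) / (σb * σ * β * cA + μ))) ^ t₂)
    (α : ℕ → EuclideanSpace ℝ (Fin n)) (Δ : ℕ → Fin K → EuclideanSpace ℝ (Fin n))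
    (happrox : ∀ t k, IsApprox A f f' g K σ β θ (I k) (α t) (Δ t k))
    (hstep : ∀ t, α (t + 1) = α t + ∑ k, Δ t k) :
    ∀ t₁ : ℕ, objF A f g (α t₁) - objF A f g αstar ≤
      (1 - (1 - (1 - (1 - θb) * ((β * σ * cA + μ) / (σb * σ * β * cA + μ))) ^ t₂) *
          (μ / (μ + σ * β * cA))) ^ t₁ *
        (objF A f g (α 0) - objF A f g αstar) := by
  intro t₁
  rcases Nat.eq_zero_or_pos K with rfl | hKpos
  · have : IsEmpty (Fin n) := ⟨fun i => (hcover i).choose.elim0⟩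
    simp [Subsingleton.elim (α t₁) αstar, Subsingleton.elim (α 0) αstar]
  have hK : K ≠ 0 := hKpos.ne'
  rw [← hθdef]
  have hθ : θ ∈ Set.Icc (0 : ℝ) 1 := by
    have h := quality_mem_Icc (mul_pos (mul_pos hβ hσ) hcA) hμ hσb hθb t₂
    rwa [show σb * (β * σ * cA) = σb * σ * β * cA by ring, ← hθdef] at h
  have hden : 0 < μ + σ * β * cA := by positivity
  have hs1 : μ / (μ + σ * β * cA) ≤ 1 :=
    (div_le_one hden).2 (by linarith [mul_pos (mul_pos hσ hβ) hcA])
  have hrate : 0 ≤ 1 - (1 - θ) * (μ / (μ + σ * β * cA)) :=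
    sub_nonneg.2 (mul_le_one₀ (by linarith [hθ.1]) (by positivity) hs1)
  have hcontract : ∀ t, objF A f g (α (t + 1)) - objF A f g αstar ≤
      (1 - (1 - θ) * (μ / (μ + σ * β * cA))) * (objF A f g (α t) - objF A f g αstar) := by
    intro t
    have hdescent := objF_add_le_sum_locF hK A hβ hsmooth g hdisj hcover hcompat (α t)
      (x := Δ t) fun k => (happrox t k).1
    have hinf := sum_locInf_le hK A hβ hconvf hgrad hμ hg hdisj hcover hσ hcA hAbound (α t) αstar
    have hzero : ∑ k, locF A f f' g K σ β (I k) (α t) 0 = objF A f g (α t) := by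
      rw [sum_locF hK A f f' g hdisj hcover σ β (α t) (x := fun _ => 0) (by simp)]
      simp [objF, mulVecE_zero]
    have hsum := sum_le_sum fun k (_ : k ∈ univ) => (happrox t k).2
    rw [← mul_sum, sum_sub_distrib, sum_sub_distrib, hzero] at hsum
    have hscaled := mul_le_mul_of_nonneg_left hinf (sub_nonneg.2 hθ.2)
    rw [hstep]
    linarith
  induction t₁ with
  | zero => simp
  | succ t ih =>
    rw [pow_succ', mul_assoc]
    exact (hcontract t).trans (mul_le_mul_of_nonneg_left ih hrate)
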